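/- arXiv:1708.03356 — 3 statements merged into one kernel-verified Lean document; each statement's English description precedes it below -/
import Mathlib

section
/- Fix n ≥ 1, a subset Λ ⊆ ℝ^{2n+1}, and s₊ ∈ ℝ. Suppose there exist r > 0 and a relative symplectic embedding of B^{2n+2}(r) into the pair ((s₊,∞) × ℝ^{2n+1}, (s₊,∞) × Λ). Then for every R > 0 there exists a relative symplectic embedding of B^{2n+2}(R) into ((s₊,∞) × ℝ^{2n+1}, (s₊,∞) × Λ). In particular, the relative Gromov width of ((s₊,∞) × ℝ^{2n+1}, (s₊,∞) × Λ) is infinite. (This is the coordinate form of Lemma 3.2 of the paper: the relative Gromov width of the top half of a Lagrangian cobordism is infinite; the proof composes the given embedding with the conformally symplectic rescaling v ↦ (r/R)v of the ball and the upward translation (s,p) ↦ (s+u,p) with e^u = (R/r)².) -/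
noncomputable section

open Real Set

/-- Euclidean dot product on `Fin m → ℝ`. -/
def dotp {m : ℕ} (a b : Fin m → ℝ) : ℝ := ∑ i, a i * b i

/-- Sum of squares (square of the Euclidean norm). -/
def nsq {m : ℕ} (a : Fin m → ℝ) : ℝ := ∑ i, (a i)^2

/-- The contactization ℝ^{2n+1}, with points (x, y, z) ∈ ℝⁿ × ℝⁿ × ℝ. -/
abbrev CPt (n : ℕ) := (Fin n → ℝ) × (Fin n → ℝ) × ℝ

/-- The symplectization ℝ × ℝ^{2n+1}, with points (s, x, y, z). -/
abbrev SPt (n : ℕ) := ℝ × CPt n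

/-- The symplectization form Ω at the point P, the coordinate expression of d(e^s(dz − y·dx)). -/
def Omega (n : ℕ) (P v w : SPt n) : ℝ :=
  Real.exp P.1 *
    (v.1 * (w.2.2.2 - dotp P.2.2.1 w.2.1) - w.1 * (v.2.2.2 - dotp P.2.2.1 v.2.1)
      + dotp v.2.1 w.2.2.1 - dotp w.2.1 v.2.2.1)

/-- The domain ℝ^{2n+2} = ℝ^{n+1} × ℝ^{n+1} of the embedded balls. -/
abbrev Dom (n : ℕ) := (Fin (n+1) → ℝ) × (Fin (n+1) → ℝ)

/-- The standard symplectic form ω₀ on ℝ^{2n+2} = ℝ^{n+1} × ℝ^{n+1}. -/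
def omega0 (n : ℕ) (v w : Dom n) : ℝ := dotp v.1 w.2 - dotp v.2 w.1

/-- The closed round ball B^{2n+2}(r) of radius r centered at 0. -/
def ballD (n : ℕ) (r : ℝ) : Set (Dom n) := {v | nsq v.1 + nsq v.2 ≤ r^2}

/-- A relative symplectic embedding of B^{2n+2}(r) into the pair (X, L): injective on
the ball, smooth on a neighborhood of the ball, derivative intertwines ω₀ with Ω, and the
preimage of L is exactly the real part B^{2n+2}(r) ∩ (ℝ^{n+1} × {0}). -/
def IsRelSymplEmb (n : ℕ) (r : ℝ) (X L : Set (SPt n)) (ψ : Dom n → SPt n) : Prop :=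
  (∀ p ∈ ballD n r, ψ p ∈ X) ∧
  Set.InjOn ψ (ballD n r) ∧
  (∃ U : Set (Dom n), IsOpen U ∧ ballD n r ⊆ U ∧ ContDiffOn ℝ (⊤ : ℕ∞) ψ U) ∧
  (∀ p ∈ ballD n r, ∀ v w : Dom n,
    Omega n (ψ p) (fderiv ℝ ψ p v) (fderiv ℝ ψ p w) = omega0 n v w) ∧
  (∀ p ∈ ballD n r, (ψ p ∈ L ↔ p.2 = 0))

/-- The relative Gromov width of (X, L): the supremum in [0,∞] of πr² over all radii r > 0
admitting a relative symplectic embedding of B^{2n+2}(r) into (X, L). -/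
def relWidth (n : ℕ) (X L : Set (SPt n)) : ENNReal :=
  ⨆ r ∈ {r : ℝ | 0 < r ∧ ∃ ψ, IsRelSymplEmb n r X L ψ}, ENNReal.ofReal (π * r^2)

lemma dotp_smul_left {m : ℕ} (c : ℝ) (a b : Fin m → ℝ) : dotp (c • a) b = c * dotp a b := by
  simp [dotp, Finset.mul_sum, mul_assoc]

lemma dotp_smul_right {m : ℕ} (c : ℝ) (a b : Fin m → ℝ) : dotp a (c • b) = c * dotp a b := by
  simp [dotp, Finset.mul_sum, mul_left_comm]

lemma nsq_smul {m : ℕ} (c : ℝ) (a : Fin m → ℝ) : nsq (c • a) = c ^ 2 * nsq a := by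
  simp [nsq, Finset.mul_sum, mul_pow]

/-- Upward translation by `u` multiplies the symplectization form by `e^u`. -/
lemma Omega_translate (n : ℕ) (u : ℝ) (P v w : SPt n) :
    Omega n (P + (u, 0)) v w = Real.exp u * Omega n P v w := by
  simp only [Omega, Prod.fst_add, Prod.snd_add, add_zero, Real.exp_add]
  ring

lemma Omega_smul_smul (n : ℕ) (c : ℝ) (P v w : SPt n) :
    Omega n P (c • v) (c • w) = c ^ 2 * Omega n P v w := by
  simp only [Omega, Prod.smul_fst, Prod.smul_snd, dotp_smul_left, dotp_smul_right, smul_eq_mul]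
  ring

lemma ballD_subset_ballD {n : ℕ} {r R : ℝ} (hr : 0 ≤ r) (h : r ≤ R) : ballD n r ⊆ ballD n R :=
  fun _ hv => le_trans hv (pow_le_pow_left₀ hr h 2)

lemma smul_mem_ballD {n : ℕ} {R : ℝ} (c : ℝ) {v : Dom n} (hv : v ∈ ballD n R) :
    c • v ∈ ballD n (c * R) := by
  simp only [ballD, Set.mem_ofPred_eq, Prod.smul_fst, Prod.smul_snd, nsq_smul, mul_pow] at hv ⊢
  rw [← mul_add]
  gcongr

/-- A relative symplectic embedding restricts to smaller balls. -/
lemma IsRelSymplEmb.mono {n : ℕ} {r R : ℝ} {X L : Set (SPt n)} {ψ : Dom n → SPt n}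
    (h : IsRelSymplEmb n R X L ψ) (hr : 0 ≤ r) (hrR : r ≤ R) : IsRelSymplEmb n r X L ψ := by
  have hsub := ballD_subset_ballD (n := n) hr hrR
  obtain ⟨hX, hinj, ⟨U, hU, hRU, hψ⟩, hΩ, hL⟩ := h
  exact ⟨fun p hp => hX p (hsub hp), hinj.mono hsub, ⟨U, hU, hsub.trans hRU, hψ⟩,
    fun p hp => hΩ p (hsub hp), fun p hp => hL p (hsub hp)⟩

/-- Rescaling the ball by `c ≤ 1` and translating upward by `-2 log c` turns a relative symplectic
embedding of the ball of radius `c R` into one of the ball of radius `R`. -/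
lemma IsRelSymplEmb.rescale {n : ℕ} {c R s : ℝ} {Λ : Set (CPt n)} {ψ : Dom n → SPt n}
    (hc : 0 < c) (hc1 : c ≤ 1)
    (h : IsRelSymplEmb n (c * R) (Set.Ioi s ×ˢ Set.univ) (Set.Ioi s ×ˢ Λ) ψ) :
    IsRelSymplEmb n R (Set.Ioi s ×ˢ Set.univ) (Set.Ioi s ×ˢ Λ)
      (fun v => ψ (c • v) + (-(2 * Real.log c), 0)) := by
  obtain ⟨hX, hinj, ⟨U, hU, hRU, hψ⟩, hΩ, hL⟩ := h
  have hlog : Real.log c ≤ 0 := Real.log_nonpos hc.le hc1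
  have hexp : Real.exp (-(2 * Real.log c)) * c ^ 2 = 1 := by
    rw [Real.exp_neg, two_mul, Real.exp_add, Real.exp_log hc]
    field_simp
  have hs : ∀ p ∈ ballD n R, s < (ψ (c • p)).1 := fun p hp => (hX _ (smul_mem_ballD c hp)).1
  have hs' : ∀ p ∈ ballD n R, s < (ψ (c • p)).1 + -(2 * Real.log c) := fun p hp => by
    linarith [hs p hp]
  refine ⟨fun p hp => ⟨hs' p hp, Set.mem_univ _⟩, ?_, ?_, ?_, ?_⟩
  · intro p hp q hq hpq
    exact smul_right_injective _ hc.ne'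
      (hinj (smul_mem_ballD c hp) (smul_mem_ballD c hq) (add_right_cancel hpq))
  · refine ⟨(fun v => c • v) ⁻¹' U, hU.preimage (continuous_const_smul c),
      fun p hp => hRU (smul_mem_ballD c hp), ?_⟩
    exact (hψ.comp (contDiff_const_smul c).contDiffOn fun _ hv => hv).add contDiffOn_const
  · intro p hp v w
    rw [fderiv_add_const, fderiv_comp_smul, Omega_translate]
    simp only [_root_.smul_apply]
    rw [Omega_smul_smul, hΩ _ (smul_mem_ballD c hp), ← mul_assoc, hexp, one_mul]
  · intro p hp
    have key := hL _ (smul_mem_ballD c hp)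
    simp only [Set.mem_prod, Set.mem_Ioi, hs p hp, true_and, Prod.smul_snd, smul_eq_zero,
      hc.ne', false_or] at key
    simpa [hs' p hp] using key

/-!
STATEMENT 1: If for some r > 0 there is a relative symplectic embedding of B^{2n+2}(r)
into ((s₊,∞) × ℝ^{2n+1}, (s₊,∞) × Λ), then for every R > 0 there is such an embedding of
B^{2n+2}(R); in particular the relative Gromov width of the pair is infinite. (Lemma 3.2.)
-/

theorem width_of_top_half_infinite (n : ℕ) (hn : 1 ≤ n) (Λ : Set (CPt n)) (splus : ℝ)
    (h : ∃ r > (0 : ℝ), ∃ ψ : Dom n → SPt n,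
      IsRelSymplEmb n r (Set.Ioi splus ×ˢ (Set.univ : Set (CPt n))) (Set.Ioi splus ×ˢ Λ) ψ) :
    (∀ R > (0 : ℝ), ∃ ψ : Dom n → SPt n,
      IsRelSymplEmb n R (Set.Ioi splus ×ˢ (Set.univ : Set (CPt n))) (Set.Ioi splus ×ˢ Λ) ψ) ∧
    relWidth n (Set.Ioi splus ×ˢ (Set.univ : Set (CPt n))) (Set.Ioi splus ×ˢ Λ) = ⊤ := by
  have hemb : ∀ R > (0 : ℝ), ∃ ψ : Dom n → SPt n,
      IsRelSymplEmb n R (Set.Ioi splus ×ˢ (Set.univ : Set (CPt n))) (Set.Ioi splus ×ˢ Λ) ψ := by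
    intro R hR
    obtain ⟨r, hr, ψ, hψ⟩ := h
    rcases le_total R r with hRr | hrR
    · exact ⟨ψ, hψ.mono hR.le hRr⟩
    · rw [← div_mul_cancel₀ r hR.ne'] at hψ
      exact ⟨_, hψ.rescale (div_pos hr hR) ((div_le_one hR).2 hrR)⟩
  refine ⟨hemb, ENNReal.eq_top_of_forall_nnreal_le fun M => ?_⟩
  have hM : (0 : ℝ) < M + 1 := by positivity
  calc (M : ENNReal) = ENNReal.ofReal M := (ENNReal.ofReal_coe_nnreal).symm
    _ ≤ ENNReal.ofReal (π * ((M : ℝ) + 1) ^ 2) := by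
      refine ENNReal.ofReal_le_ofReal ?_
      nlinarith [Real.pi_gt_three, M.coe_nonneg, sq_nonneg ((M : ℝ) + 1)]
    _ ≤ _ := le_iSup₂_of_le ((M : ℝ) + 1) ⟨hM, hemb _ hM⟩ le_rfl
end
end

section
/- Fix n ≥ 1, a nonempty open set V ⊆ ℝⁿ, smooth functions f₋, f₊ : V → ℝ, and h > 0 such that f₊(x) − f₋(x) > h for all x ∈ V. Let j¹f_± = {(x, ∇f_±(x), f_±(x)) : x ∈ V} ⊆ ℝ^{2n+1} denote the 1-jet graphs, and let Λ ⊆ ℝ^{2n+1} be any subset such that j¹f₋ ⊆ Λ and Λ ∩ {(x,y,z) : x ∈ V, |z − f₋(x)| < h} ⊆ j¹f₋ ∪ j¹f₊. Then for every r > 0 with πr² < 2h there exists a relative symplectic embedding of B^{2n+2}(r) into ((−∞,0) × ℝ^{2n+1}, (−∞,0) × Λ). In particular, 2h ≤ w((ℝ × Λ)_{−∞}^0). (This is the local-model core of Theorem 1.2 of the paper: near a frontwise doubly extendable Reeb chord of height h, the Legendrian Λ is a union of two 1-jet graphs whose z-values differ by more than h − ε₁ on a neighborhood V, and the constructed ball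 of capacity arbitrarily close to 2h meets the cylinder over Λ exactly in its real part, which maps into the cylinder over the lower sheet j¹f₋.) -/
noncomputable section

open Real Set

/-!
STATEMENT 5: Local-model core of Theorem 1.2: if on a nonempty open V ⊆ ℝⁿ the Legendrian Λ
contains the 1-jet graph of f₋ and, within the slab |z − f₋(x)| < h over V, is contained in
the union of the 1-jet graphs of f₋ and f₊ with f₊ − f₋ > h on V, then every ball of
capacity πr² < 2h embeds relatively into ((−∞,0) × ℝ^{2n+1}, (−∞,0) × Λ); in particular
2h ≤ w((ℝ × Λ)_{−∞}^0).
-/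

/-- Coordinate gradient of f : ℝⁿ → ℝ. -/
def gradf {n : ℕ} (f : (Fin n → ℝ) → ℝ) (x : Fin n → ℝ) : Fin n → ℝ :=
  fun i => fderiv ℝ f x (Pi.single i 1)

/-- The 1-jet graph j¹f = {(x, ∇f(x), f(x)) : x ∈ V} ⊆ ℝ^{2n+1}. -/
def oneJet {n : ℕ} (f : (Fin n → ℝ) → ℝ) (V : Set (Fin n → ℝ)) : Set (CPt n) :=
  {q | ∃ x ∈ V, q = (x, gradf f x, f x)}

lemma nsq_nonneg {m : ℕ} (a : Fin m → ℝ) : 0 ≤ nsq a :=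
  Finset.sum_nonneg fun i _ => sq_nonneg (a i)

lemma sq_le_nsq {m : ℕ} (a : Fin m → ℝ) (i : Fin m) : a i ^ 2 ≤ nsq a :=
  Finset.single_le_sum (f := fun i => a i ^ 2) (fun i _ => sq_nonneg (a i)) (Finset.mem_univ i)

lemma dotp_succ {m : ℕ} (a b : Fin (m + 1) → ℝ) :
    dotp a b = a 0 * b 0 + dotp (fun i => a i.succ) (fun i => b i.succ) := by
  simp [dotp, Fin.sum_univ_succ]

lemma dotp_clm {m : ℕ} (L : (Fin m → ℝ) →L[ℝ] ℝ) (v : Fin m → ℝ) :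
    dotp v (fun i => L (Pi.single i 1)) = L v := by
  conv_rhs => rw [pi_eq_sum_univ' v]
  simp [dotp, map_sum]

/-- The function `q ↦ 1/2 + (1/h) ∫₀^q √(R² - u²) du`. -/
def areaFun (R h q : ℝ) : ℝ :=
  1 / 2 + (q * √(R ^ 2 - q ^ 2) + R ^ 2 * arcsin (q / R)) / (2 * h)

lemma sq_sub_sq_pos {R q : ℝ} (hq : q ∈ Ioo (-R) R) : 0 < R ^ 2 - q ^ 2 := by
  nlinarith [hq.1, hq.2]

lemma hasDerivAt_areaFun {R h q : ℝ} (hh : 0 < h) (hq : q ∈ Ioo (-R) R) :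
    HasDerivAt (areaFun R h) (√(R ^ 2 - q ^ 2) / h) q := by
  have hR : 0 < R := by linarith [hq.1, hq.2]
  have hp := sq_sub_sq_pos hq
  have hS : 0 < √(R ^ 2 - q ^ 2) := sqrt_pos.2 hp
  have hS2 : √(R ^ 2 - q ^ 2) ^ 2 = R ^ 2 - q ^ 2 := sq_sqrt hp.le
  have h1 : HasDerivAt (fun q => √(R ^ 2 - q ^ 2)) (-(2 * q) / (2 * √(R ^ 2 - q ^ 2))) q := by
    have := (((hasDerivAt_id q).pow 2).const_sub (R ^ 2)).sqrt hp.ne'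
    simpa using this
  have h2 : HasDerivAt (fun q => arcsin (q / R)) (1 / √(1 - (q / R) ^ 2) * (1 / R)) q := by
    refine (hasDerivAt_arcsin ?_ ?_).comp q ((hasDerivAt_id q).div_const R)
    · exact ((lt_div_iff₀ hR).2 (by linarith [hq.1])).ne'
    · exact ((div_lt_iff₀ hR).2 (by linarith [hq.2])).ne
  have h3 : √(1 - (q / R) ^ 2) = √(R ^ 2 - q ^ 2) / R := by
    rw [show 1 - (q / R) ^ 2 = (R ^ 2 - q ^ 2) / R ^ 2 by field_simp, sqrt_div hp.le,
      sqrt_sq hR.le]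
  rw [h3] at h2
  have h4 := ((((hasDerivAt_id q).mul h1).add (h2.const_mul (R ^ 2))).div_const (2 * h)).const_add
    (1 / 2)
  refine h4.congr_deriv ?_
  simp only [id]
  field_simp
  rw [hS2]
  ring

lemma continuous_areaFun (R h : ℝ) : Continuous (areaFun R h) := by
  unfold areaFun
  have := continuous_arcsin
  fun_prop

lemma strictMonoOn_areaFun {R h : ℝ} (hh : 0 < h) : StrictMonoOn (areaFun R h) (Icc (-R) R) := by
  refine strictMonoOn_of_deriv_pos (convex_Icc _ _) (continuous_areaFun R h).continuousOn ?_
  intro q hq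
  rw [interior_Icc] at hq
  rw [(hasDerivAt_areaFun hh hq).deriv]
  exact div_pos (sqrt_pos.2 (sq_sub_sq_pos hq)) hh

lemma areaFun_mem_Ioo {R h q : ℝ} (hh : 0 < h) (hR : π * R ^ 2 < 2 * h) (hq : q ∈ Ioo (-R) R) :
    areaFun R h q ∈ Ioo (0 : ℝ) 1 := by
  have hR0 : 0 < R := by linarith [hq.1, hq.2]
  have h1 := strictMonoOn_areaFun hh (left_mem_Icc.2 (by linarith)) ⟨hq.1.le, hq.2.le⟩ hq.1
  have h2 := strictMonoOn_areaFun hh ⟨hq.1.le, hq.2.le⟩ (right_mem_Icc.2 (by linarith)) hq.2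
  have e1 : areaFun R h (-R) = 1 / 2 - π * R ^ 2 / (4 * h) := by
    simp [areaFun, neg_div, hR0.ne']
    field_simp
    ring
  have e2 : areaFun R h R = 1 / 2 + π * R ^ 2 / (4 * h) := by
    simp [areaFun, hR0.ne']
    field_simp
    ring
  have h3 : π * R ^ 2 / (4 * h) < 1 / 2 := by
    rw [div_lt_iff₀ (by positivity)]
    linarith
  constructor <;> linarith

lemma contDiffOn_sqrt_sq_sub_sq (R : ℝ) :
    ContDiffOn ℝ (⊤ : ℕ∞) (fun q => √(R ^ 2 - q ^ 2)) (Ioo (-R) R) :=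
  ContDiffOn.sqrt (by fun_prop) fun _ hq => (sq_sub_sq_pos hq).ne'

lemma contDiffOn_areaFun (R h : ℝ) :
    ContDiffOn ℝ (⊤ : ℕ∞) (areaFun R h) (Ioo (-R) R) := by
  unfold areaFun
  have h1 := contDiffOn_sqrt_sq_sub_sq R
  have h2 : ContDiffOn ℝ (⊤ : ℕ∞) (fun q => arcsin (q / R)) (Ioo (-R) R) := by
    intro q hq
    have hR : 0 < R := by linarith [hq.1, hq.2]
    refine ((contDiffAt_arcsin ?_ ?_).comp q (contDiffAt_fun_id.div_const R)).contDiffWithinAt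
    · exact ((lt_div_iff₀ hR).2 (by linarith [hq.1])).ne'
    · exact ((div_lt_iff₀ hR).2 (by linarith [hq.2])).ne
  fun_prop

/-- The base point of `ℝⁿ` associated with a point of the ball. -/
def basePt {n : ℕ} (x₀ : Fin n → ℝ) (δ : ℝ) (u : Dom n) : Fin n → ℝ :=
  fun i => x₀ i + δ * u.1 i.succ

/-- The map to the symplectization which reads off `(e^s, z - f)` from the first symplectic pair
through the area-preserving map `(q, p) ↦ (T q, p / g q)`, and `(x, e^s (y - ∇f))` from the
remaining pairs through the linear map `(q, p) ↦ (x₀ + δ q, p / δ)`. -/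
def chordMap {n : ℕ} (T g : ℝ → ℝ) (f : (Fin n → ℝ) → ℝ) (x₀ : Fin n → ℝ) (δ : ℝ) (u : Dom n) :
    SPt n :=
  (log (T (u.1 0)), basePt x₀ δ u,
    fun i => u.2 i.succ / (δ * T (u.1 0)) + gradf f (basePt x₀ δ u) i,
    u.2 0 / g (u.1 0) + f (basePt x₀ δ u))

lemma contDiff_basePt {n : ℕ} (x₀ : Fin n → ℝ) (δ : ℝ) :
    ContDiff ℝ (⊤ : ℕ∞) (basePt x₀ δ : Dom n → Fin n → ℝ) := by
  unfold basePt
  fun_prop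

section chordMap

variable {n : ℕ} {V : Set (Fin n → ℝ)} {f : (Fin n → ℝ) → ℝ} {T g : ℝ → ℝ} {I : Set ℝ}
  {x₀ : Fin n → ℝ} {δ : ℝ}

lemma contDiffOn_fderiv_of_isOpen (hV : IsOpen V) (hf : ContDiffOn ℝ (⊤ : ℕ∞) f V) :
    ContDiffOn ℝ (⊤ : ℕ∞) (fderiv ℝ f) V :=
  hf.fderiv_of_isOpen hV (by simp)

lemma contDiffOn_chordMap (hV : IsOpen V) (hf : ContDiffOn ℝ (⊤ : ℕ∞) f V)
    (hT : ContDiffOn ℝ (⊤ : ℕ∞) T I) (hg : ContDiffOn ℝ (⊤ : ℕ∞) g I)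
    (hT0 : ∀ q ∈ I, T q ≠ 0) (hg0 : ∀ q ∈ I, g q ≠ 0) (hδ : δ ≠ 0) :
    ContDiffOn ℝ (⊤ : ℕ∞) (chordMap T g f x₀ δ) {u | u.1 0 ∈ I ∧ basePt x₀ δ u ∈ V} := by
  set U : Set (Dom n) := {u | u.1 0 ∈ I ∧ basePt x₀ δ u ∈ V}
  have hq : ContDiffOn ℝ (⊤ : ℕ∞) (fun u : Dom n => u.1 0) U := by fun_prop
  have hb : ContDiffOn ℝ (⊤ : ℕ∞) (basePt x₀ δ) U := (contDiff_basePt x₀ δ).contDiffOn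
  have hTU : ContDiffOn ℝ (⊤ : ℕ∞) (fun u : Dom n => T (u.1 0)) U := hT.comp hq fun u hu => hu.1
  have hgU : ContDiffOn ℝ (⊤ : ℕ∞) (fun u : Dom n => g (u.1 0)) U := hg.comp hq fun u hu => hu.1
  have hfU : ContDiffOn ℝ (⊤ : ℕ∞) (fun u : Dom n => f (basePt x₀ δ u)) U :=
    hf.comp hb fun u hu => hu.2
  have hdU : ContDiffOn ℝ (⊤ : ℕ∞) (fun u : Dom n => fderiv ℝ f (basePt x₀ δ u)) U :=
    (contDiffOn_fderiv_of_isOpen hV hf).comp hb fun u hu => hu.2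
  refine (hTU.log fun u hu => hT0 _ hu.1).prodMk (hb.prodMk (ContDiffOn.prodMk ?_ ?_))
  · refine contDiffOn_pi.2 fun i => ContDiffOn.add ?_ ?_
    · exact ContDiffOn.div (by fun_prop) (contDiffOn_const.mul hTU)
        fun u hu => mul_ne_zero hδ (hT0 _ hu.1)
    · exact hdU.clm_apply contDiffOn_const
  · exact (ContDiffOn.div (by fun_prop) hgU fun u hu => hg0 _ hu.1).add hfU

lemma fderiv_chordMap_apply (hV : IsOpen V) (hf : ContDiffOn ℝ (⊤ : ℕ∞) f V) {u : Dom n}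
    {g' : ℝ} (hψ : DifferentiableAt ℝ (chordMap T g f x₀ δ) u) (hx : basePt x₀ δ u ∈ V)
    (hT : HasDerivAt T (g (u.1 0)) (u.1 0)) (hg : HasDerivAt g g' (u.1 0))
    (hT0 : T (u.1 0) ≠ 0) (hg0 : g (u.1 0) ≠ 0) (hδ : δ ≠ 0) (v : Dom n) :
    fderiv ℝ (chordMap T g f x₀ δ) u v =
      (g (u.1 0) * v.1 0 / T (u.1 0), δ • fun i => v.1 i.succ,
        fun i => (v.2 i.succ * (δ * T (u.1 0)) - u.2 i.succ * (δ * (g (u.1 0) * v.1 0)))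
            / (δ * T (u.1 0)) ^ 2
          + fderiv ℝ (fderiv ℝ f) (basePt x₀ δ u) (δ • fun i => v.1 i.succ) (Pi.single i 1),
        (v.2 0 * g (u.1 0) - u.2 0 * (g' * v.1 0)) / g (u.1 0) ^ 2
          + fderiv ℝ f (basePt x₀ δ u) (δ • fun i => v.1 i.succ)) := by
  have hl : HasDerivAt (fun τ : ℝ => u + τ • v) v 0 := by
    simpa using ((hasDerivAt_id (0 : ℝ)).smul_const v).const_add u
  have hl1 : ∀ i, HasDerivAt (fun τ : ℝ => (u + τ • v).1 i) (v.1 i) 0 := fun i =>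
    hasDerivAt_pi.1 hl.fst i
  have hl2 : ∀ i, HasDerivAt (fun τ : ℝ => (u + τ • v).2 i) (v.2 i) 0 := fun i =>
    hasDerivAt_pi.1 hl.snd i
  have e0 : u + (0 : ℝ) • v = u := by simp
  have hlT : HasDerivAt (fun τ : ℝ => T ((u + τ • v).1 0)) (g (u.1 0) * v.1 0) 0 :=
    HasDerivAt.comp 0 (by rwa [e0]) (hl1 0)
  have hlg : HasDerivAt (fun τ : ℝ => g ((u + τ • v).1 0)) (g' * v.1 0) 0 :=
    HasDerivAt.comp 0 (h₂ := g) (by rwa [e0]) (hl1 0)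
  have hlb : HasDerivAt (fun τ : ℝ => basePt x₀ δ (u + τ • v)) (δ • fun i => v.1 i.succ) 0 :=
    hasDerivAt_pi.2 fun i => ((hl1 i.succ).const_mul δ).const_add (x₀ i)
  have hVx := hV.mem_nhds hx
  have hlf : HasDerivAt (fun τ : ℝ => f (basePt x₀ δ (u + τ • v)))
      (fderiv ℝ f (basePt x₀ δ u) (δ • fun i => v.1 i.succ)) 0 := by
    have := ((hf.contDiffAt hVx).differentiableAt (by simp)).hasFDerivAt
    exact HasFDerivAt.comp_hasDerivAt 0 (l := f) (by rwa [e0]) hlb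
  have hld : HasDerivAt (fun τ : ℝ => fderiv ℝ f (basePt x₀ δ (u + τ • v)))
      (fderiv ℝ (fderiv ℝ f) (basePt x₀ δ u) (δ • fun i => v.1 i.succ)) 0 := by
    have := (((contDiffOn_fderiv_of_isOpen hV hf).contDiffAt hVx).differentiableAt
      (by simp)).hasFDerivAt
    exact HasFDerivAt.comp_hasDerivAt 0 (l := fderiv ℝ f) (by rwa [e0]) hlb
  have hmain := (hlT.log (by rwa [e0])).prodMk (hlb.prodMk (HasDerivAt.prodMk
    (hasDerivAt_pi.2 fun i : Fin n => ((hl2 i.succ).div (hlT.const_mul δ)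
      (by rw [e0]; exact mul_ne_zero hδ hT0)).add (hld.clm_apply (hasDerivAt_const 0
        (Pi.single i (1 : ℝ) : Fin n → ℝ))))
    (((hl2 0).div hlg (by rwa [e0])).add hlf)))
  have hcomp : HasDerivAt (fun τ : ℝ => chordMap T g f x₀ δ (u + τ • v))
      (fderiv ℝ (chordMap T g f x₀ δ) u v) 0 :=
    HasFDerivAt.comp_hasDerivAt 0 (l := chordMap T g f x₀ δ)
      (by rw [e0]; exact hψ.hasFDerivAt) hl
  refine (hcomp.unique hmain).trans ?_
  simp only [e0, map_zero, add_zero]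

lemma Omega_fderiv_chordMap (hV : IsOpen V) (hf : ContDiffOn ℝ (⊤ : ℕ∞) f V) {u : Dom n}
    {g' : ℝ} (hψ : DifferentiableAt ℝ (chordMap T g f x₀ δ) u) (hx : basePt x₀ δ u ∈ V)
    (hT : HasDerivAt T (g (u.1 0)) (u.1 0)) (hg : HasDerivAt g g' (u.1 0))
    (hT0 : 0 < T (u.1 0)) (hg0 : g (u.1 0) ≠ 0) (hδ : δ ≠ 0) (v w : Dom n) :
    Omega n (chordMap T g f x₀ δ u) (fderiv ℝ (chordMap T g f x₀ δ) u v)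
      (fderiv ℝ (chordMap T g f x₀ δ) u w) = omega0 n v w := by
  have hsymm : IsSymmSndFDerivAt ℝ f (basePt x₀ δ u) :=
    (hf.contDiffAt (hV.mem_nhds hx)).isSymmSndFDerivAt
      (by simpa using WithTop.coe_le_coe.2 (le_top : (2 : ℕ∞) ≤ ⊤))
  have hHess := hsymm.eq (δ • fun i => v.1 i.succ) (δ • fun i => w.1 i.succ)
  rw [fderiv_chordMap_apply hV hf hψ hx hT hg hT0.ne' hg0 hδ,
    fderiv_chordMap_apply hV hf hψ hx hT hg hT0.ne' hg0 hδ]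
  set t := T (u.1 0)
  set c := g (u.1 0)
  have hdot_y : ∀ a : Dom n, dotp (chordMap T g f x₀ δ u).2.2.1 (δ • fun i => a.1 i.succ) =
      dotp (fun i => u.2 i.succ) (fun i => a.1 i.succ) / t
        + fderiv ℝ f (basePt x₀ δ u) (δ • fun i => a.1 i.succ) := by
    intro a
    rw [← dotp_clm]
    simp only [dotp, chordMap, gradf, Pi.smul_apply, smul_eq_mul, Finset.sum_div,
      ← Finset.sum_add_distrib]
    refine Finset.sum_congr rfl fun i _ => ?_
    change (u.2 i.succ / (δ * t) + _) * _ = _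
    field_simp
  have hdot_Y : ∀ a b : Dom n, dotp (δ • fun i => a.1 i.succ)
      (fun i => (b.2 i.succ * (δ * t) - u.2 i.succ * (δ * (c * b.1 0))) / (δ * t) ^ 2
          + fderiv ℝ (fderiv ℝ f) (basePt x₀ δ u) (δ • fun i => b.1 i.succ) (Pi.single i 1)) =
      dotp (fun i => a.1 i.succ) (fun i => b.2 i.succ) / t
        - dotp (fun i => u.2 i.succ) (fun i => a.1 i.succ) * (c * b.1 0) / t ^ 2
        + fderiv ℝ (fderiv ℝ f) (basePt x₀ δ u) (δ • fun i => b.1 i.succ)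
          (δ • fun i => a.1 i.succ) := by
    intro a b
    rw [← dotp_clm (fderiv ℝ (fderiv ℝ f) (basePt x₀ δ u) (δ • fun i => b.1 i.succ))]
    simp only [dotp, Pi.smul_apply, smul_eq_mul, Finset.sum_div, Finset.sum_mul,
      ← Finset.sum_add_distrib, ← Finset.sum_sub_distrib]
    refine Finset.sum_congr rfl fun i _ => ?_
    field_simp
  have hexp : exp (chordMap T g f x₀ δ u).1 = t := exp_log hT0
  have hcomm : dotp (fun i : Fin n => v.2 i.succ) (fun i => w.1 i.succ) =
      dotp (fun i => w.1 i.succ) (fun i => v.2 i.succ) := by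
    simp only [dotp, mul_comm]
  simp only [Omega, hexp, hdot_y, hdot_Y, hHess, omega0, dotp_succ, hcomm]
  field_simp
  ring

lemma injOn_chordMap {S : Set (Dom n)} (hS : ∀ u ∈ S, u.1 0 ∈ I) (hT : InjOn T I)
    (hT0 : ∀ q ∈ I, 0 < T q) (hg0 : ∀ q ∈ I, g q ≠ 0) (hδ : δ ≠ 0) :
    InjOn (chordMap T g f x₀ δ) S := by
  intro u hu v hv huv
  have h1 : log (T (u.1 0)) = log (T (v.1 0)) := congrArg Prod.fst huv
  have hb : basePt x₀ δ u = basePt x₀ δ v := congrArg (fun P => P.2.1) huv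
  have hy : ∀ i, (chordMap T g f x₀ δ u).2.2.1 i = (chordMap T g f x₀ δ v).2.2.1 i := by
    intro i
    rw [huv]
  have hz : (chordMap T g f x₀ δ u).2.2.2 = (chordMap T g f x₀ δ v).2.2.2 := by rw [huv]
  have hq : u.1 0 = v.1 0 := hT (hS u hu) (hS v hv)
    (log_injOn_pos (hT0 _ (hS u hu)) (hT0 _ (hS v hv)) h1)
  have ht := (hT0 _ (hS v hv)).ne'
  have hg := hg0 _ (hS v hv)
  simp only [chordMap, hq, hb, add_left_inj, div_left_inj' hg,
    div_left_inj' (mul_ne_zero hδ ht)] at hy hz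
  refine Prod.ext (funext fun i => ?_) (funext fun i => ?_)
  · refine Fin.cases hq (fun j => ?_) i
    have := congrFun hb j
    simpa [basePt, hδ] using this
  · exact Fin.cases hz hy i

lemma chordMap_snd_mem_iff {u : Dom n} {h : ℝ} {fp : (Fin n → ℝ) → ℝ} {Λ : Set (CPt n)}
    (hgap : ∀ x ∈ V, fp x - f x > h) (hsub : oneJet f V ⊆ Λ)
    (hloc : Λ ∩ {q : CPt n | q.1 ∈ V ∧ |q.2.2 - f q.1| < h} ⊆ oneJet f V ∪ oneJet fp V)
    (hx : basePt x₀ δ u ∈ V) (hT0 : T (u.1 0) ≠ 0) (hg0 : g (u.1 0) ≠ 0) (hδ : δ ≠ 0)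
    (hz : |u.2 0 / g (u.1 0)| < h) :
    (chordMap T g f x₀ δ u).2 ∈ Λ ↔ u.2 = 0 := by
  constructor
  · intro hu
    rcases hloc ⟨hu, hx, by simpa [chordMap] using hz⟩ with ⟨x, _, h2⟩ | ⟨x, _, h2⟩
    · obtain rfl : basePt x₀ δ u = x := congrArg Prod.fst h2
      have hy : ∀ i : Fin n, _ = _ := fun i => congrFun (congrArg (fun P => P.2.1) h2) i
      have hz' := congrArg (fun P => P.2.2) h2
      simp only [chordMap, add_eq_right, div_eq_zero_iff, mul_eq_zero, hT0, hg0, hδ,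
        or_false] at hy hz'
      exact funext fun i => Fin.cases hz' hy i
    · obtain rfl : basePt x₀ δ u = x := congrArg Prod.fst h2
      have hz' : u.2 0 / g (u.1 0) + f _ = fp _ := congrArg (fun P => P.2.2) h2
      have := hgap _ hx
      linarith [(abs_lt.1 hz).2]
  · intro hu
    refine hsub ⟨_, hx, ?_⟩
    simp [chordMap, hu]

end chordMap

lemma exists_ball_emb {n : ℕ} {V : Set (Fin n → ℝ)} (hV : IsOpen V) (hVne : V.Nonempty)
    {fm fp : (Fin n → ℝ) → ℝ} (hfm : ContDiffOn ℝ (⊤ : ℕ∞) fm V)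
    {h : ℝ} (hh : 0 < h) (hgap : ∀ x ∈ V, fp x - fm x > h)
    {Λ : Set (CPt n)} (hsub : oneJet fm V ⊆ Λ)
    (hloc : Λ ∩ {q : CPt n | q.1 ∈ V ∧ |q.2.2 - fm q.1| < h} ⊆ oneJet fm V ∪ oneJet fp V)
    {r : ℝ} (hr : 0 < r) (hrh : π * r ^ 2 < 2 * h) :
    ∃ ψ : Dom n → SPt n,
      IsRelSymplEmb n r (Set.Iio (0 : ℝ) ×ˢ (Set.univ : Set (CPt n)))
        (Set.Iio (0 : ℝ) ×ˢ Λ) ψ := by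
  obtain ⟨R, hrR, hR⟩ : ∃ R, r < R ∧ π * R ^ 2 < 2 * h := by
    have hr' : r < √(2 * h / π) := by
      rw [lt_sqrt hr.le, lt_div_iff₀ pi_pos]
      linarith
    obtain ⟨R, h1, h2⟩ := exists_between hr'
    rw [lt_sqrt (hr.trans h1).le, lt_div_iff₀ pi_pos] at h2
    exact ⟨R, h1, by linarith⟩
  obtain ⟨x₀, hx₀⟩ := hVne
  obtain ⟨ε, hε, hεV⟩ := Metric.isOpen_iff.1 hV x₀ hx₀
  set δ := ε / (2 * r) with hδdef
  have hδ : 0 < δ := by positivity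
  set T := areaFun R h
  set g : ℝ → ℝ := fun q => √(R ^ 2 - q ^ 2) / h with hgdef
  have hgC : ContDiffOn ℝ (⊤ : ℕ∞) g (Ioo (-R) R) := (contDiffOn_sqrt_sq_sub_sq R).div_const h
  have hg0 : ∀ q ∈ Ioo (-R) R, 0 < g q := fun q hq =>
    div_pos (sqrt_pos.2 (sq_sub_sq_pos hq)) hh
  have hT0 : ∀ q ∈ Ioo (-R) R, T q ∈ Ioo (0 : ℝ) 1 := fun q hq => areaFun_mem_Ioo hh hR hq
  have hq1 : ∀ u ∈ ballD n r, ∀ i, |u.1 i| ≤ r := fun u hu i =>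
    abs_le_of_sq_le_sq (by
      have h1 : nsq u.1 + nsq u.2 ≤ r ^ 2 := hu
      linarith [sq_le_nsq u.1 i, nsq_nonneg u.2]) hr.le
  have hqI : ∀ u ∈ ballD n r, u.1 0 ∈ Ioo (-R) R := fun u hu =>
    abs_lt.1 ((hq1 u hu 0).trans_lt hrR)
  have hxV : ∀ u ∈ ballD n r, basePt x₀ δ u ∈ V := by
    intro u hu
    refine hεV ?_
    rw [Metric.mem_ball, dist_pi_lt_iff hε]
    intro i
    rw [Real.dist_eq, basePt, add_sub_cancel_left, abs_mul, abs_of_pos hδ]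
    calc δ * |u.1 i.succ| ≤ δ * r := by gcongr; exact hq1 u hu _
      _ = ε / 2 := by rw [hδdef]; field_simp
      _ < ε := by linarith
  have hzh : ∀ u ∈ ballD n r, |u.2 0 / g (u.1 0)| < h := by
    intro u hu
    have h1 : nsq u.1 + nsq u.2 ≤ r ^ 2 := hu
    have h2 : |u.2 0| < √(R ^ 2 - u.1 0 ^ 2) := by
      rw [← sqrt_sq_eq_abs]
      refine sqrt_lt_sqrt (sq_nonneg _) ?_
      have := pow_lt_pow_left₀ hrR hr.le two_ne_zero
      linarith [sq_le_nsq u.1 0, sq_le_nsq u.2 0]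
    rw [abs_div, abs_of_pos (hg0 _ (hqI u hu)), div_lt_iff₀ (hg0 _ (hqI u hu)), hgdef]
    field_simp
    exact h2
  set U : Set (Dom n) := {u | u.1 0 ∈ Ioo (-R) R ∧ basePt x₀ δ u ∈ V}
  have hU : IsOpen U := by
    refine (isOpen_Ioo.preimage ?_).inter (hV.preimage (contDiff_basePt x₀ δ).continuous)
    fun_prop
  have hUb : ballD n r ⊆ U := fun u hu => ⟨hqI u hu, hxV u hu⟩
  have hψ : ContDiffOn ℝ (⊤ : ℕ∞) (chordMap T g fm x₀ δ) U :=
    contDiffOn_chordMap hV hfm (contDiffOn_areaFun R h) hgC (fun q hq => (hT0 q hq).1.ne')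
      (fun q hq => (hg0 q hq).ne') hδ.ne'
  have hs : ∀ u ∈ ballD n r, (chordMap T g fm x₀ δ u).1 < 0 := fun u hu =>
    log_neg (hT0 _ (hqI u hu)).1 (hT0 _ (hqI u hu)).2
  refine ⟨chordMap T g fm x₀ δ, fun u hu => ⟨hs u hu, mem_univ _⟩, ?_, ⟨U, hU, hUb, hψ⟩, ?_, ?_⟩
  · exact injOn_chordMap hqI ((strictMonoOn_areaFun hh).injOn.mono Ioo_subset_Icc_self)
      (fun q hq => (hT0 q hq).1) (fun q hq => (hg0 q hq).ne') hδ.ne'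
  · intro u hu v w
    have hq := hqI u hu
    exact Omega_fderiv_chordMap hV hfm
      ((hψ.contDiffAt (hU.mem_nhds (hUb hu))).differentiableAt (by simp)) (hxV u hu)
      (hasDerivAt_areaFun hh hq)
      ((hgC.contDiffAt (isOpen_Ioo.mem_nhds hq)).differentiableAt (by simp)).hasDerivAt
      (hT0 _ hq).1 (hg0 _ hq).ne' hδ.ne' v w
  · intro u hu
    have hq := hqI u hu
    rw [← chordMap_snd_mem_iff hgap hsub hloc (hxV u hu) (hT0 _ hq).1.ne' (hg0 _ hq).ne' hδ.ne'
      (hzh u hu)]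
    exact ⟨fun hm => hm.2, fun hm => ⟨hs u hu, hm⟩⟩

theorem lower_bound_near_chord (n : ℕ) (hn : 1 ≤ n) (V : Set (Fin n → ℝ))
    (hV : IsOpen V) (hVne : V.Nonempty)
    (fm fp : (Fin n → ℝ) → ℝ) (hfm : ContDiffOn ℝ (⊤ : ℕ∞) fm V) (hfp : ContDiffOn ℝ (⊤ : ℕ∞) fp V)
    (h : ℝ) (hh : 0 < h) (hgap : ∀ x ∈ V, fp x - fm x > h)
    (Λ : Set (CPt n)) (hsub : oneJet fm V ⊆ Λ)
    (hloc : Λ ∩ {q : CPt n | q.1 ∈ V ∧ |q.2.2 - fm q.1| < h} ⊆ oneJet fm V ∪ oneJet fp V) :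
    (∀ r > (0 : ℝ), π * r ^ 2 < 2 * h →
      ∃ ψ : Dom n → SPt n,
        IsRelSymplEmb n r (Set.Iio (0 : ℝ) ×ˢ (Set.univ : Set (CPt n)))
          (Set.Iio (0 : ℝ) ×ˢ Λ) ψ) ∧
    ENNReal.ofReal (2 * h)
      ≤ relWidth n (Set.Iio (0 : ℝ) ×ˢ (Set.univ : Set (CPt n))) (Set.Iio (0 : ℝ) ×ˢ Λ) := by
  have hemb := fun r (hr : 0 < r) (hrh : π * r ^ 2 < 2 * h) =>
    exists_ball_emb hV hVne hfm hh hgap hsub hloc hr hrh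
  refine ⟨hemb, le_of_forall_lt fun c hc => ?_⟩
  obtain ⟨a, ha0, hca, hah⟩ := ENNReal.lt_iff_exists_real_btwn.1 hc
  have hah' : a < 2 * h := (ENNReal.ofReal_lt_ofReal_iff (by positivity)).1 hah
  have ha : 0 < a := ENNReal.ofReal_pos.1 (bot_le.trans_lt hca)
  have hsq : π * √(a / π) ^ 2 = a := by
    rw [sq_sqrt (by positivity)]
    field_simp
  have hpos : 0 < √(a / π) := sqrt_pos.2 (by positivity)
  refine hca.trans_le ?_
  rw [← hsq]
  exact le_iSup₂_of_le (√(a / π)) ⟨hpos, hemb _ hpos (hsq.trans_lt hah')⟩ le_rfl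
end
end

section
/- Let a, b, r > 0 satisfy πr² < 2ab. Then there exists a map ψ from the closed disk B²(r) = {v ∈ ℝ² : |v| ≤ r} into the open rectangle (0,a) × (−b,b) ⊆ ℝ² such that: ψ is injective; ψ is smooth on a neighborhood of B²(r); ψ is symplectic, i.e., for every p ∈ B²(r) the derivative Dψ_p satisfies ω₀(Dψ_p v, Dψ_p w) = ω₀(v,w) for all v,w ∈ ℝ² (equivalently det Dψ_p = 1, so ψ is area- and orientation-preserving); and ψ⁻¹( (0,a) × {0} ) = B²(r) ∩ (ℝ × {0}). That is, a closed round disk of area πr² < 2ab embeds symplectically into the rectangle of area 2ab relative to the horizontal axis. (This is the two-dimensional relative embedding σ₁ : B²(r) ↪ (A × B, A × {0}) used in the proof of Theorem 1.2, where A × B is a rectangle of area at least πr².) -/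
noncomputable section

open Real Set

/-!
STATEMENT 10: A closed round disk of area πr² < 2ab admits a relative symplectic (i.e.,
area- and orientation-preserving) embedding into the open rectangle (0,a) × (−b,b),
relative to the horizontal axis: the preimage of (0,a) × {0} is the real part of the disk.
(This is the two-dimensional relative embedding σ₁ used in the proof of Theorem 1.2.)
-/

/-- The standard area form ω₀ = dx∧dy on ℝ². -/
def omega2 (v w : ℝ × ℝ) : ℝ := v.1 * w.2 - v.2 * w.1

/-- The closed round disk B²(r) of radius r centered at the origin. -/
def disk2 (r : ℝ) : Set (ℝ × ℝ) := {p | p.1 ^ 2 + p.2 ^ 2 ≤ r ^ 2}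

lemma div_ne_one_of_mem_Ioo {s x : ℝ} (hs : 0 < s) (hx : x ∈ Ioo (-s) s) :
    x / s ≠ -1 ∧ x / s ≠ 1 := by
  constructor <;> intro h <;> rw [div_eq_iff hs.ne'] at h <;> linarith [hx.1, hx.2]

/-- `a / 2` plus `1 / b` times the signed area of the part of the upper half disk of radius `s` between
the vertical axis and the vertical line through `x`. -/
def halfDiskArea (a b s x : ℝ) : ℝ :=
  a / 2 + (x * √(s ^ 2 - x ^ 2) + s ^ 2 * arcsin (x / s)) / (2 * b)

lemma hasDerivAt_halfDiskArea (a : ℝ) {b s x : ℝ} (hb : 0 < b) (hs : 0 < s)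
    (hx : x ∈ Ioo (-s) s) :
    HasDerivAt (halfDiskArea a b s) (√(s ^ 2 - x ^ 2) / b) x := by
  have hpos : 0 < s ^ 2 - x ^ 2 := by nlinarith [hx.1, hx.2]
  have hsqrt := Real.sqrt_pos.2 hpos
  obtain ⟨h₁, h₂⟩ := div_ne_one_of_mem_Ioo hs hx
  have hd : HasDerivAt (fun t : ℝ => s ^ 2 - t ^ 2) (-(2 * x)) x := by
    simpa using (hasDerivAt_pow 2 x).const_sub (s ^ 2)
  have hasin : HasDerivAt (fun t : ℝ => arcsin (t / s)) (1 / √(1 - (x / s) ^ 2) * (1 / s)) x :=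
    HasDerivAt.comp (h₂ := arcsin) (h := fun t : ℝ => t / s) x (hasDerivAt_arcsin h₁ h₂)
      ((hasDerivAt_id x).div_const s)
  have hroot : √(1 - (x / s) ^ 2) = √(s ^ 2 - x ^ 2) / s := by
    rw [show 1 - (x / s) ^ 2 = (s ^ 2 - x ^ 2) / s ^ 2 by field_simp, Real.sqrt_div hpos.le,
      Real.sqrt_sq hs.le]
  have key := ((((hasDerivAt_id x).mul (hd.sqrt hpos.ne')).add
    (hasin.const_mul (s ^ 2))).div_const (2 * b)).const_add (a / 2)
  refine key.congr_deriv ?_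
  have hsq := Real.sq_sqrt hpos.le
  rw [hroot]
  simp only [id]
  field_simp
  rw [hsq]
  ring

lemma strictMonoOn_halfDiskArea (a : ℝ) {b s : ℝ} (hb : 0 < b) (hs : 0 < s) :
    StrictMonoOn (halfDiskArea a b s) (Icc (-s) s) := by
  refine strictMonoOn_of_deriv_pos (convex_Icc _ _) ?_ ?_
  · have := continuous_arcsin
    unfold halfDiskArea
    fun_prop
  · intro x hx
    rw [interior_Icc] at hx
    rw [(hasDerivAt_halfDiskArea a hb hs hx).deriv]
    have hpos : 0 < s ^ 2 - x ^ 2 := by nlinarith [hx.1, hx.2]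
    exact div_pos (Real.sqrt_pos.2 hpos) hb

lemma halfDiskArea_mem_Ioo {a b s x : ℝ} (hb : 0 < b) (hs : 0 < s)
    (harea : π * s ^ 2 ≤ 2 * a * b) (hx : x ∈ Ioo (-s) s) :
    halfDiskArea a b s x ∈ Ioo 0 a := by
  have hmono := strictMonoOn_halfDiskArea a hb hs
  have hle : s ^ 2 * (π / 2) / (2 * b) ≤ a / 2 := by
    rw [div_le_iff₀ (by positivity)]
    linarith
  have hl := hmono (left_mem_Icc.2 (by linarith)) (Ioo_subset_Icc_self hx) hx.1
  have hr := hmono (Ioo_subset_Icc_self hx) (right_mem_Icc.2 (by linarith)) hx.2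
  simp only [halfDiskArea, neg_sq, sub_self, Real.sqrt_zero, mul_zero, zero_add, neg_div,
    div_self hs.ne', arcsin_neg, arcsin_one, mul_neg] at hl hr
  exact ⟨lt_of_le_of_lt (by linarith) hl, lt_of_lt_of_le hr (by linarith)⟩

lemma contDiffAt_halfDiskArea (a b : ℝ) {s x : ℝ} (hs : 0 < s) (hx : x ∈ Ioo (-s) s) :
    ContDiffAt ℝ (⊤ : ℕ∞) (halfDiskArea a b s) x := by
  have hpos : 0 < s ^ 2 - x ^ 2 := by nlinarith [hx.1, hx.2]
  obtain ⟨h₁, h₂⟩ := div_ne_one_of_mem_Ioo hs hx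
  have hsqrt : ContDiffAt ℝ (⊤ : ℕ∞) (fun t : ℝ => √(s ^ 2 - t ^ 2)) x :=
    (contDiffAt_const.sub (contDiffAt_id.pow 2)).sqrt hpos.ne'
  have hasin : ContDiffAt ℝ (⊤ : ℕ∞) (fun t : ℝ => arcsin (t / s)) x :=
    ContDiffAt.comp (g := arcsin) (f := fun t : ℝ => t / s) x (contDiffAt_arcsin h₁ h₂)
      (contDiffAt_id.div_const s)
  exact contDiffAt_const.add
    (((contDiffAt_id.mul hsqrt).add (contDiffAt_const.mul hasin)).div_const (2 * b))

/-- A map `(x, y) ↦ (F x, y * g x)` with `F' * g = 1` preserves the area form. -/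
lemma omega2_fderiv_shear {F g : ℝ → ℝ} {F' : ℝ} {p : ℝ × ℝ} (hF : HasDerivAt F F' p.1)
    (hg : DifferentiableAt ℝ g p.1) (h : F' * g p.1 = 1) (v w : ℝ × ℝ) :
    omega2 (fderiv ℝ (fun q : ℝ × ℝ => (F q.1, q.2 * g q.1)) p v)
      (fderiv ℝ (fun q : ℝ × ℝ => (F q.1, q.2 * g q.1)) p w) = omega2 v w := by
  have hfst : HasFDerivAt (fun q : ℝ × ℝ => q.1) (ContinuousLinearMap.fst ℝ ℝ ℝ) p :=
    hasFDerivAt_fst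
  have hsnd : HasFDerivAt (fun q : ℝ × ℝ => q.2) (ContinuousLinearMap.snd ℝ ℝ ℝ) p :=
    hasFDerivAt_snd
  have h₁ := hF.comp_hasFDerivAt p hfst
  have h₂ := hg.hasDerivAt.comp_hasFDerivAt p hfst
  have hψ : HasFDerivAt (fun q : ℝ × ℝ => (F q.1, q.2 * g q.1)) _ p := h₁.prodMk (hsnd.mul h₂)
  rw [hψ.fderiv]
  simp only [omega2, ContinuousLinearMap.prod_apply, add_apply,
    smul_apply, ContinuousLinearMap.coe_fst', ContinuousLinearMap.coe_snd',
    smul_eq_mul]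
  linear_combination (v.1 * w.2 - v.2 * w.1) * h

theorem disk_into_rectangle (a b r : ℝ) (ha : 0 < a) (hb : 0 < b) (hr : 0 < r)
    (harea : π * r ^ 2 < 2 * a * b) :
    ∃ ψ : ℝ × ℝ → ℝ × ℝ,
      (∀ p ∈ disk2 r, ψ p ∈ Set.Ioo 0 a ×ˢ Set.Ioo (-b) b) ∧
      Set.InjOn ψ (disk2 r) ∧
      (∃ U : Set (ℝ × ℝ), IsOpen U ∧ disk2 r ⊆ U ∧ ContDiffOn ℝ (⊤ : ℕ∞) ψ U) ∧
      (∀ p ∈ disk2 r, ∀ v w : ℝ × ℝ,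
        omega2 (fderiv ℝ ψ p v) (fderiv ℝ ψ p w) = omega2 v w) ∧
      (∀ p ∈ disk2 r, (ψ p ∈ Set.Ioo 0 a ×ˢ ({0} : Set ℝ) ↔ p.2 = 0)) := by
  obtain ⟨s, hrs, hs_area⟩ : ∃ s, r < s ∧ π * s ^ 2 < 2 * a * b := by
    have hcont : ContinuousAt (fun s : ℝ => π * s ^ 2) r := by fun_prop
    have hev := (hcont.eventually_lt continuousAt_const harea).filter_mono
      (nhdsWithin_le_nhds (s := Ioi r))
    exact ((eventually_mem_nhdsWithin.and hev).exists).imp fun _ h => h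
  have hs : 0 < s := hr.trans hrs
  have hmem : ∀ p ∈ disk2 r, p.1 ∈ Ioo (-s) s := fun p hp =>
    abs_lt.1 (abs_lt_of_sq_lt_sq
      (by nlinarith [sq_nonneg p.2, show p.1 ^ 2 + p.2 ^ 2 ≤ r ^ 2 from hp]) hs.le)
  have hpos : ∀ x ∈ Ioo (-s) s, 0 < s ^ 2 - x ^ 2 := fun x hx => by nlinarith [hx.1, hx.2]
  set g : ℝ → ℝ := fun x => b / √(s ^ 2 - x ^ 2) with hg
  have hgpos : ∀ x ∈ Ioo (-s) s, 0 < g x := fun x hx =>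
    div_pos hb (Real.sqrt_pos.2 (hpos x hx))
  have hgdiff : ∀ x ∈ Ioo (-s) s, ContDiffAt ℝ (⊤ : ℕ∞) g x := fun x hx =>
    contDiffAt_const.div ((contDiffAt_const.sub (contDiffAt_id.pow 2)).sqrt (hpos x hx).ne')
      (Real.sqrt_pos.2 (hpos x hx)).ne'
  refine ⟨fun q => (halfDiskArea a b s q.1, q.2 * g q.1), ?_, ?_, ?_, ?_, ?_⟩
  · intro p hp
    have hx := hmem p hp
    refine ⟨halfDiskArea_mem_Ioo hb hs hs_area.le hx, ?_⟩
    have hsqrt := Real.sqrt_pos.2 (hpos p.1 hx)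
    have hy : |p.2| < √(s ^ 2 - p.1 ^ 2) := by
      refine Real.lt_sqrt_of_sq_lt ?_
      rw [sq_abs]
      nlinarith [show p.1 ^ 2 + p.2 ^ 2 ≤ r ^ 2 from hp]
    refine abs_lt.1 ?_
    rw [abs_mul, abs_of_pos (hgpos _ hx), hg, ← mul_div_assoc, div_lt_iff₀ hsqrt, mul_comm]
    exact mul_lt_mul_of_pos_left hy hb
  · intro p hp q hq hpq
    obtain ⟨h₁, h₂⟩ := Prod.mk.inj hpq
    have hx := hmem p hp
    have h : p.1 = q.1 := (strictMonoOn_halfDiskArea a hb hs).injOn (Ioo_subset_Icc_self hx)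
      (Ioo_subset_Icc_self (hmem q hq)) h₁
    rw [← h] at h₂
    exact Prod.ext h (mul_right_cancel₀ (hgpos _ hx).ne' h₂)
  · refine ⟨Prod.fst ⁻¹' Ioo (-s) s, isOpen_Ioo.preimage continuous_fst, hmem, fun p hp => ?_⟩
    exact (((contDiffAt_halfDiskArea a b hs hp).comp p contDiffAt_fst).prodMk
      (contDiffAt_snd.mul ((hgdiff p.1 hp).comp p contDiffAt_fst))).contDiffWithinAt
  · intro p hp v w
    have hx := hmem p hp
    have hsqrt := (Real.sqrt_pos.2 (hpos p.1 hx)).ne'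
    refine omega2_fderiv_shear (hasDerivAt_halfDiskArea a hb hs hx)
      ((hgdiff p.1 hx).differentiableAt (by simp)) ?_ v w
    rw [hg]
    field_simp
  · intro p hp
    have hx := hmem p hp
    simp only [mem_prod, mem_singleton_iff, mul_eq_zero, (hgpos _ hx).ne', or_false,
      halfDiskArea_mem_Ioo hb hs hs_area.le hx, true_and]
end
end
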